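/- Let d ≥ 1. There exist positive constants C₂ and C₃, depending only on d, such that for every ρ > 0, every α ≥ C₂, and every real-valued twice continuously differentiable function f on ℝ^d whose closed support is contained in B(0,ρ) ∖ {0}, one has the Carleman-type inequality α³ ∫_{ℝ^d} w_ρ(x)^{−1−2α} f(x)² dx ≤ C₃ · ρ⁴ · ∫_{ℝ^d} w_ρ(x)^{2−2α} (Δf(x))² dx. -/

import Mathlib

open MeasureTheory

/-- The Laplacian `Δf = ∑ j ∂²f/∂x_j²` of a function on `ℝ^d`. -/
noncomputable def lap {d : ℕ} (f : EuclideanSpace ℝ (Fin d) → ℝ)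
    (x : EuclideanSpace ℝ (Fin d)) : ℝ :=
  ∑ i, fderiv ℝ (fun y => fderiv ℝ f y (EuclideanSpace.single i 1)) x
    (EuclideanSpace.single i 1)

/-- The weight function `φ(s) = s · exp(-∫₀^s (1-e^{-t})/t dt)`, the integrand being
continuously extended by the value `1` at `t = 0`; `w_ρ(x) = φ(|x|/ρ)`. -/
noncomputable def phiWeight (s : ℝ) : ℝ :=
  s * Real.exp (-∫ t in (0 : ℝ)..s, if t = 0 then 1 else (1 - Real.exp (-t)) / t)

theorem continuous_phiWeight_integrand :
    Continuous (fun t : ℝ => if t = 0 then (1 : ℝ) else (1 - Real.exp (-t)) / t) := by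
  have h : (fun t : ℝ => if t = 0 then (1 : ℝ) else (1 - Real.exp (-t)) / t)
      = dslope (fun t : ℝ => -Real.exp (-t)) 0 := by
    have hd : HasDerivAt (fun t : ℝ => -Real.exp (-t)) 1 0 := by
      have := ((hasDerivAt_neg (0 : ℝ)).exp).neg
      exact this.congr_deriv (by simp)
    funext t
    by_cases ht : t = 0
    · simp only [ht, if_true, dslope_same, hd.deriv]
    · rw [if_neg ht, dslope_of_ne _ ht, slope_def_field]
      simp
      ring
  rw [h, continuous_iff_continuousAt]
  intro t
  by_cases ht : t = 0
  · subst ht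
    rw [continuousAt_dslope_same]
    fun_prop
  · rw [continuousAt_dslope_of_ne ht]
    fun_prop

theorem phiWeight_integrand_le_one {t : ℝ} (ht : 0 ≤ t) :
    (if t = 0 then (1 : ℝ) else (1 - Real.exp (-t)) / t) ≤ 1 := by
  split_ifs with h
  · exact le_rfl
  · rw [div_le_one (lt_of_le_of_ne ht (Ne.symm h))]
    linarith [Real.add_one_le_exp (-t)]

theorem phiWeight_pos {s : ℝ} (hs : 0 < s) : 0 < phiWeight s :=
  mul_pos hs (Real.exp_pos _)

theorem mul_exp_neg_one_le_phiWeight {s : ℝ} (h0 : 0 ≤ s) (h1 : s ≤ 1) :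
    s * Real.exp (-1) ≤ phiWeight s := by
  unfold phiWeight
  gcongr
  calc ∫ t in (0 : ℝ)..s, (if t = 0 then (1 : ℝ) else (1 - Real.exp (-t)) / t)
      ≤ ∫ _ in (0 : ℝ)..s, (1 : ℝ) :=
        intervalIntegral.integral_mono_on h0
          (continuous_phiWeight_integrand.intervalIntegrable _ _)
          (continuous_const.intervalIntegrable _ _)
          (fun t ht => phiWeight_integrand_le_one ht.1)
    _ ≤ 1 := by simpa using h1

theorem hasDerivAt_phiWeight {s : ℝ} (hs : s ≠ 0) :
    HasDerivAt phiWeight (Real.exp (-s) / s * phiWeight s) s := by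
  have h := (hasDerivAt_id s).mul
    (continuous_phiWeight_integrand.integral_hasStrictDerivAt 0 s).hasDerivAt.neg.exp
  refine h.congr_deriv ?_
  simp only [if_neg hs, phiWeight, id, Pi.neg_apply]
  field_simp
  ring

theorem contDiff_phiWeight : ContDiff ℝ 1 phiWeight := by
  have h : ContDiff ℝ 1 (fun s : ℝ => ∫ t in (0 : ℝ)..s,
      if t = 0 then (1 : ℝ) else (1 - Real.exp (-t)) / t) := by
    rw [contDiff_one_iff_deriv]
    refine ⟨fun s => (continuous_phiWeight_integrand.integral_hasStrictDerivAt 0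
      s).hasDerivAt.differentiableAt, ?_⟩
    have : deriv (fun s : ℝ => ∫ t in (0 : ℝ)..s,
        if t = 0 then (1 : ℝ) else (1 - Real.exp (-t)) / t) = _ :=
      funext fun s => continuous_phiWeight_integrand.deriv_integral _ 0 s
    rw [this]
    exact continuous_phiWeight_integrand
  unfold phiWeight
  fun_prop

section

variable {d : ℕ}

theorem hasFDerivAt_comp_norm {g : ℝ → ℝ} {g' : ℝ} {x : EuclideanSpace ℝ (Fin d)}
    (hx : x ≠ 0) (hg : HasDerivAt g g' ‖x‖) :
    HasFDerivAt (fun y : EuclideanSpace ℝ (Fin d) => g ‖y‖) ((g' / ‖x‖) • innerSL ℝ x) x := by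
  have h1 : HasFDerivAt (fun y : EuclideanSpace ℝ (Fin d) => ‖y‖)
      ((1 / ‖x‖) • innerSL ℝ x) x := by
    have h := (hasStrictFDerivAt_norm_sq x).hasFDerivAt.sqrt
      (by have := norm_pos_iff.2 hx; positivity)
    simp only [Real.sqrt_sq (norm_nonneg _)] at h
    refine h.congr_fderiv ?_
    ext v
    simp
    field_simp
  refine (hg.comp_hasFDerivAt x h1).congr_fderiv ?_
  ext v
  simp
  field_simp

theorem integral_fderiv_apply_eq_zero {F : EuclideanSpace ℝ (Fin d) → ℝ}
    (hF : ContDiff ℝ 1 F) (hc : HasCompactSupport F) (v : EuclideanSpace ℝ (Fin d)) :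
    Integrable (fun x => fderiv ℝ F x v) ∧ ∫ x, fderiv ℝ F x v = 0 := by
  have hi : Integrable (fun x => fderiv ℝ F x v) :=
    ((hF.continuous_fderiv one_ne_zero).clm_apply continuous_const).integrable_of_hasCompactSupport
      (hc.fderiv_apply ℝ v)
  refine ⟨hi, ?_⟩
  have h := integral_mul_fderiv_eq_neg_fderiv_mul_of_integrable (𝕜 := ℝ)
    (μ := (volume : Measure (EuclideanSpace ℝ (Fin d)))) (f := F) (g := fun _ => (1:ℝ)) (v := v)
    (by simpa using hi) (by simp)
    (by simpa using hF.continuous.integrable_of_hasCompactSupport hc)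
    (fun x _ => hF.differentiable one_ne_zero x) (fun _ _ => differentiableAt_const _)
  simpa using h.symm


/-- The components of the vector field used in the Rellich-type identity, with radial coefficients
`m`, `γ` and `b`. -/
noncomputable def rellichField (m γ b : ℝ → ℝ) (f : EuclideanSpace ℝ (Fin d) → ℝ) (i : Fin d)
    (x : EuclideanSpace ℝ (Fin d)) : ℝ :=
  m ‖x‖ * ((∑ j, x j * fderiv ℝ f x (EuclideanSpace.single j 1)) + γ ‖x‖ * f x)
      * fderiv ℝ f x (EuclideanSpace.single i 1)
    - (m ‖x‖ * (∑ j, fderiv ℝ f x (EuclideanSpace.single j 1) ^ 2) / 2 + b ‖x‖ * f x ^ 2) * x i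

theorem fderiv_fderiv_single_comm {f : EuclideanSpace ℝ (Fin d) → ℝ} (hf : ContDiff ℝ 2 f)
    (x v w : EuclideanSpace ℝ (Fin d)) :
    fderiv ℝ (fun y => fderiv ℝ f y v) x w = fderiv ℝ (fun y => fderiv ℝ f y w) x v := by
  have hd : DifferentiableAt ℝ (fderiv ℝ f) x :=
    (hf.fderiv_right (m := 1) (by norm_num)).differentiable one_ne_zero x
  have hs : IsSymmSndFDerivAt ℝ f x := hf.contDiffAt.isSymmSndFDerivAt (by simp)
  rw [fderiv_clm_apply hd (by fun_prop), fderiv_clm_apply hd (by fun_prop)]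
  simpa using hs w v

theorem sum_fderiv_rellichField {m γ b : ℝ → ℝ} {m' γ' b' : ℝ}
    {f : EuclideanSpace ℝ (Fin d) → ℝ} (hf : ContDiff ℝ 2 f)
    {x : EuclideanSpace ℝ (Fin d)} (hx : x ≠ 0) (hm : HasDerivAt m m' ‖x‖)
    (hγ : HasDerivAt γ γ' ‖x‖) (hb : HasDerivAt b b' ‖x‖) :
    ∑ i, fderiv ℝ (rellichField m γ b f i) x (EuclideanSpace.single i 1) =
      m ‖x‖ * ((∑ j, x j * fderiv ℝ f x (EuclideanSpace.single j 1)) + γ ‖x‖ * f x) * lap f x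
      + m' / ‖x‖ * (∑ j, x j * fderiv ℝ f x (EuclideanSpace.single j 1))
        * ((∑ j, x j * fderiv ℝ f x (EuclideanSpace.single j 1)) + γ ‖x‖ * f x)
      + (m ‖x‖ * γ' / ‖x‖ - 2 * b ‖x‖)
        * (∑ j, x j * fderiv ℝ f x (EuclideanSpace.single j 1)) * f x
      - (‖x‖ * b' + d * b ‖x‖) * f x ^ 2
      + (m ‖x‖ * (1 + γ ‖x‖ - d / 2) - ‖x‖ * m' / 2)
        * ∑ j, fderiv ℝ f x (EuclideanSpace.single j 1) ^ 2 := by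
  have hr : ‖x‖ ≠ 0 := norm_ne_zero_iff.2 hx
  set p : Fin d → EuclideanSpace ℝ (Fin d) → ℝ :=
    fun j y => fderiv ℝ f y (EuclideanSpace.single j 1) with hpdef
  set H : Fin d → Fin d → ℝ := fun i j => fderiv ℝ (p j) x (EuclideanSpace.single i 1) with hH
  have hp : ∀ j, HasFDerivAt (p j) (fderiv ℝ (p j) x) x := fun j =>
    (((hf.fderiv_right (m := 1) (by norm_num)).clm_apply contDiff_const).differentiable
      one_ne_zero x).hasFDerivAt
  have hfd : HasFDerivAt f (fderiv ℝ f x) x := (hf.differentiable two_ne_zero x).hasFDerivAt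
  have hc : ∀ j : Fin d, HasFDerivAt (fun y : EuclideanSpace ℝ (Fin d) => y j)
      (EuclideanSpace.proj j : EuclideanSpace ℝ (Fin d) →L[ℝ] ℝ) x := fun j =>
    (EuclideanSpace.proj j : EuclideanSpace ℝ (Fin d) →L[ℝ] ℝ).hasFDerivAt
  have hM := hasFDerivAt_comp_norm hx hm
  have hG := hasFDerivAt_comp_norm hx hγ
  have hB := hasFDerivAt_comp_norm hx hb
  set E : ℝ := ∑ j, x j * p j x with hEdef
  set N : ℝ := ∑ j, p j x ^ 2 with hNdef
  obtain ⟨E', hE, hE'⟩ : ∃ E' : EuclideanSpace ℝ (Fin d) →L[ℝ] ℝ,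
      HasFDerivAt (fun y => ∑ j, y j * p j y) E' x ∧
      ∀ i, E' (EuclideanSpace.single i 1) = p i x + ∑ j, x j * H i j := by
    refine ⟨_, HasFDerivAt.fun_sum fun j _ => (hc j).mul (hp j), fun i => ?_⟩
    simp [Finset.sum_add_distrib, hH, add_comm, PiLp.single_apply]
  obtain ⟨N', hN, hN'⟩ : ∃ N' : EuclideanSpace ℝ (Fin d) →L[ℝ] ℝ,
      HasFDerivAt (fun y => ∑ j, p j y ^ 2) N' x ∧
      ∀ i, N' (EuclideanSpace.single i 1) = 2 * ∑ j, p j x * H i j := by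
    refine ⟨_, HasFDerivAt.fun_sum fun j _ => (hp j).pow 2, fun i => ?_⟩
    simp [hH, Finset.mul_sum, mul_assoc]
  have key : ∀ i, fderiv ℝ (rellichField m γ b f i) x (EuclideanSpace.single i 1) =
      (m' / ‖x‖ * (E + γ ‖x‖ * f x) + m ‖x‖ * (γ' / ‖x‖) * f x - 2 * b ‖x‖ * f x) * (x i * p i x)
      + m ‖x‖ * (1 + γ ‖x‖) * p i x ^ 2
      + m ‖x‖ * (p i x * ∑ j, x j * H i j)
      + m ‖x‖ * (E + γ ‖x‖ * f x) * H i i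
      - (m' / ‖x‖ * N / 2 + b' / ‖x‖ * f x ^ 2) * x i ^ 2
      - m ‖x‖ * (x i * ∑ j, p j x * H i j)
      - (m ‖x‖ * N / 2 + b ‖x‖ * f x ^ 2) := by
    intro i
    have h := ((hM.mul (hE.add (hG.mul hfd))).mul (hp i)).sub
      ((((hM.mul hN).mul_const (1 / 2 : ℝ)).add (hB.mul (hfd.pow 2))).mul (hc i))
    rw [(h.congr_of_eventuallyEq (f₁ := rellichField m γ b f i)
      (Filter.Eventually.of_forall fun y => by
        simp only [rellichField, p, Pi.sub_apply, Pi.mul_apply, Pi.add_apply]; ring)).fderiv]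
    have hfi : fderiv ℝ f x (EuclideanSpace.single i 1) = p i x := rfl
    have hHi : fderiv ℝ (p i) x (EuclideanSpace.single i 1) = H i i := rfl
    simp [EuclideanSpace.inner_single_right, hE', hN', hfi, hHi, ← hEdef, ← hNdef]
    ring
  have hsymm : ∀ i j, H i j = H j i := fun i j => fderiv_fderiv_single_comm hf x _ _
  have hQ : ∑ i, x i * ∑ j, p j x * H i j = ∑ i, p i x * ∑ j, x j * H i j := by
    simp only [Finset.mul_sum]
    rw [Finset.sum_comm]
    refine Finset.sum_congr rfl fun i _ => Finset.sum_congr rfl fun j _ => ?_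
    rw [hsymm j i]
    ring
  have hR : ∑ i, x i ^ 2 = ‖x‖ ^ 2 := (EuclideanSpace.real_norm_sq_eq x).symm
  have hL : lap f x = ∑ i, H i i := rfl
  simp only [key, Finset.sum_sub_distrib, Finset.sum_add_distrib, ← Finset.mul_sum, hQ, hR, hL,
    ← hEdef, ← hNdef, Finset.sum_const, Finset.card_univ, Fintype.card_fin, nsmul_eq_mul]
  field_simp
  ring

theorem rellichField_eq_zero (m γ b : ℝ → ℝ) {f : EuclideanSpace ℝ (Fin d) → ℝ} (i : Fin d)
    {x : EuclideanSpace ℝ (Fin d)} (hx : x ∉ tsupport f) : rellichField m γ b f i x = 0 := by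
  simp [rellichField, image_eq_zero_of_notMem_tsupport hx, fderiv_of_notMem_tsupport ℝ hx]

theorem eventually_notMem_tsupport {f : EuclideanSpace ℝ (Fin d) → ℝ}
    {x : EuclideanSpace ℝ (Fin d)} (hx : x ∉ tsupport f) : ∀ᶠ y in nhds x, y ∉ tsupport f :=
  (isClosed_tsupport f).isOpen_compl.mem_nhds hx

theorem contDiff_rellichField {m γ b : ℝ → ℝ} {f : EuclideanSpace ℝ (Fin d) → ℝ}
    (hf : ContDiff ℝ 2 f) (h0 : (0 : EuclideanSpace ℝ (Fin d)) ∉ tsupport f)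
    (hm : ∀ r, 0 < r → ContDiffAt ℝ 1 m r) (hγ : ∀ r, 0 < r → ContDiffAt ℝ 1 γ r)
    (hb : ∀ r, 0 < r → ContDiffAt ℝ 1 b r) (i : Fin d) :
    ContDiff ℝ 1 (rellichField m γ b f i) := by
  rw [contDiff_iff_contDiffAt]
  intro x
  by_cases hx : x = 0
  · subst hx
    exact (contDiffAt_const (c := (0 : ℝ))).congr_of_eventuallyEq <|
      (eventually_notMem_tsupport h0).mono fun y hy => rellichField_eq_zero m γ b i hy
  · have hr := norm_pos_iff.2 hx
    have hn : ContDiffAt ℝ 1 (fun y : EuclideanSpace ℝ (Fin d) => ‖y‖) x := contDiffAt_norm ℝ hx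
    have hM : ContDiffAt ℝ 1 (fun y : EuclideanSpace ℝ (Fin d) => m ‖y‖) x := (hm _ hr).comp x hn
    have hG : ContDiffAt ℝ 1 (fun y : EuclideanSpace ℝ (Fin d) => γ ‖y‖) x := (hγ _ hr).comp x hn
    have hB : ContDiffAt ℝ 1 (fun y : EuclideanSpace ℝ (Fin d) => b ‖y‖) x := (hb _ hr).comp x hn
    have hp : ∀ j : Fin d, ContDiffAt ℝ 1
        (fun y => fderiv ℝ f y (EuclideanSpace.single j 1)) x := fun j =>
      ((hf.fderiv_right (m := 1) (by norm_num)).clm_apply contDiff_const).contDiffAt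
    have hc : ∀ j : Fin d, ContDiffAt ℝ 1 (fun y : EuclideanSpace ℝ (Fin d) => y j) x :=
      fun j => (EuclideanSpace.proj j : EuclideanSpace ℝ (Fin d) →L[ℝ] ℝ).contDiff.contDiffAt
    have hf1 : ContDiffAt ℝ 1 f x := (hf.of_le (by norm_num)).contDiffAt
    exact ((hM.mul ((ContDiffAt.sum fun j _ => (hc j).mul (hp j)).add (hG.mul hf1))).mul
      (hp i)).sub ((((hM.mul (ContDiffAt.sum fun j _ => (hp j).pow 2)).div_const 2).add
        (hB.mul (hf1.pow 2))).mul (hc i))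

theorem integral_sum_fderiv_rellichField {m γ b : ℝ → ℝ} {f : EuclideanSpace ℝ (Fin d) → ℝ}
    (hf : ContDiff ℝ 2 f) (hc : HasCompactSupport f)
    (h0 : (0 : EuclideanSpace ℝ (Fin d)) ∉ tsupport f)
    (hm : ∀ r, 0 < r → ContDiffAt ℝ 1 m r) (hγ : ∀ r, 0 < r → ContDiffAt ℝ 1 γ r)
    (hb : ∀ r, 0 < r → ContDiffAt ℝ 1 b r) :
    Integrable (fun x => ∑ i, fderiv ℝ (rellichField m γ b f i) x (EuclideanSpace.single i 1)) ∧
      ∫ x, ∑ i, fderiv ℝ (rellichField m γ b f i) x (EuclideanSpace.single i 1) = 0 := by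
  have h := fun i => integral_fderiv_apply_eq_zero
    (contDiff_rellichField hf h0 hm hγ hb i)
    (HasCompactSupport.intro hc fun x hx => rellichField_eq_zero m γ b i hx)
    (EuclideanSpace.single i 1)
  refine ⟨integrable_finsetSum _ fun i _ => (h i).1, ?_⟩
  rw [integral_finsetSum _ fun i _ => (h i).1]
  exact Finset.sum_eq_zero fun i _ => (h i).2

theorem sum_fderiv_rellichField_eq_zero (m γ b : ℝ → ℝ) {f : EuclideanSpace ℝ (Fin d) → ℝ}
    {x : EuclideanSpace ℝ (Fin d)} (hx : x ∉ tsupport f) :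
    ∑ i, fderiv ℝ (rellichField m γ b f i) x (EuclideanSpace.single i 1) = 0 := by
  refine Finset.sum_eq_zero fun i _ => ?_
  have h : rellichField m γ b f i =ᶠ[nhds x] fun _ => (0 : ℝ) :=
    (eventually_notMem_tsupport hx).mono fun y hy => rellichField_eq_zero m γ b i hy
  rw [h.fderiv_eq]
  simp

theorem lap_eq_zero {f : EuclideanSpace ℝ (Fin d) → ℝ} {x : EuclideanSpace ℝ (Fin d)}
    (hx : x ∉ tsupport f) : lap f x = 0 := by
  refine Finset.sum_eq_zero fun i _ => ?_
  have h : (fun y => fderiv ℝ f y (EuclideanSpace.single i 1)) =ᶠ[nhds x] fun _ => (0 : ℝ) :=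
    (eventually_notMem_tsupport hx).mono fun y hy => by
      simp [fderiv_of_notMem_tsupport ℝ hy]
  rw [h.fderiv_eq]
  simp

theorem continuous_lap {f : EuclideanSpace ℝ (Fin d) → ℝ} (hf : ContDiff ℝ 2 f) :
    Continuous (lap f) := by
  refine continuous_finsetSum _ fun i _ => ?_
  exact (((hf.fderiv_right (m := 1) (by norm_num)).clm_apply contDiff_const).continuous_fderiv
    one_ne_zero).clm_apply continuous_const

theorem contDiffAt_phiWeight_div_rpow {ρ : ℝ} (hρ : 0 < ρ) (c : ℝ) {r : ℝ} (hr : 0 < r) :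
    ContDiffAt ℝ 1 (fun r => phiWeight (r / ρ) ^ c) r :=
  ((contDiff_phiWeight.contDiffAt.comp r (contDiffAt_id.div_const ρ))).rpow_const_of_ne
    (phiWeight_pos (div_pos hr hρ)).ne'

theorem hasDerivAt_phiWeight_div_rpow {ρ : ℝ} (hρ : 0 < ρ) (c : ℝ) {r : ℝ} (hr : 0 < r) :
    HasDerivAt (fun r => phiWeight (r / ρ) ^ c)
      (c * Real.exp (-(r / ρ)) / r * phiWeight (r / ρ) ^ c) r := by
  have hs : 0 < r / ρ := div_pos hr hρ
  have hw := phiWeight_pos hs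
  have h1 : HasDerivAt (fun r => phiWeight (r / ρ))
      (Real.exp (-(r / ρ)) / (r / ρ) * phiWeight (r / ρ) * (1 / ρ)) r :=
    HasDerivAt.comp (h₂ := phiWeight) r (hasDerivAt_phiWeight hs.ne') ((hasDerivAt_id r).div_const ρ)
  refine (h1.rpow_const (p := c) (Or.inl hw.ne')).congr_deriv ?_
  rw [Real.rpow_sub_one hw.ne']
  field_simp

theorem integrable_phiWeight_mul {ρ : ℝ} (hρ : 0 < ρ) (c : ℝ)
    {f g : EuclideanSpace ℝ (Fin d) → ℝ} (hc : HasCompactSupport f)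
    (h0 : (0 : EuclideanSpace ℝ (Fin d)) ∉ tsupport f) (hg : Continuous g)
    (hz : ∀ x ∉ tsupport f, g x = 0) :
    Integrable (fun x => phiWeight (‖x‖ / ρ) ^ c * g x) := by
  refine Continuous.integrable_of_hasCompactSupport ?_
    (HasCompactSupport.intro hc fun x hx => by simp [hz x hx])
  rw [continuous_iff_continuousAt]
  intro x
  by_cases hx : x = 0
  · subst hx
    exact (continuousAt_const (y := (0 : ℝ))).congr <|
      (eventually_notMem_tsupport h0).mono fun y hy => by simp [hz y hy]
  · refine ContinuousAt.mul ?_ hg.continuousAt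
    exact (contDiffAt_phiWeight_div_rpow hρ c (norm_pos_iff.2 hx)).continuousAt.comp
      (f := fun y : EuclideanSpace ℝ (Fin d) => ‖y‖) continuous_norm.continuousAt

/-- The radial coefficient of the first order term in the multiplier `x · ∇f + γ f`. -/
noncomputable def carlemanCoeff (d : ℕ) (ρ α r : ℝ) : ℝ :=
  ((d : ℝ) - 2) / 2 - α * Real.exp (-(r / ρ))

/-- The radial coefficient of the zeroth order part of the vector field. -/
noncomputable def carlemanPotential (d : ℕ) (ρ α r : ℝ) : ℝ :=
  phiWeight (r / ρ) ^ (-(2 * α)) * (r ^ 2)⁻¹ *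
    (α * Real.exp (-(r / ρ)) * (r / ρ + 2 * carlemanCoeff d ρ α r) / 2)

theorem hasDerivAt_exp_neg_div (ρ r : ℝ) :
    HasDerivAt (fun r => Real.exp (-(r / ρ))) (-(Real.exp (-(r / ρ)) / ρ)) r := by
  refine ((hasDerivAt_id r).div_const ρ).neg.exp.congr_deriv ?_
  simp
  ring

theorem hasDerivAt_carlemanCoeff (d : ℕ) (ρ α r : ℝ) :
    HasDerivAt (carlemanCoeff d ρ α) (α * (Real.exp (-(r / ρ)) / ρ)) r := by
  refine (((hasDerivAt_exp_neg_div ρ r).const_mul α).const_sub (((d : ℝ) - 2) / 2)).congr_deriv ?_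
  ring

theorem contDiff_carlemanCoeff (d : ℕ) (ρ α : ℝ) : ContDiff ℝ 1 (carlemanCoeff d ρ α) := by
  unfold carlemanCoeff
  fun_prop

theorem contDiffAt_carlemanPotential (d : ℕ) {ρ : ℝ} (hρ : 0 < ρ) (α : ℝ) {r : ℝ} (hr : 0 < r) :
    ContDiffAt ℝ 1 (carlemanPotential d ρ α) r := by
  have h1 := contDiffAt_phiWeight_div_rpow hρ (-(2 * α)) hr
  have h2 : ContDiffAt ℝ 1 (fun r : ℝ => (r ^ 2)⁻¹) r :=
    (contDiffAt_id.pow 2).inv (pow_pos hr 2).ne'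
  have h3 := contDiff_carlemanCoeff d ρ α
  exact (h1.mul h2).mul (by fun_prop)

theorem hasDerivAt_carlemanPotential (d : ℕ) {ρ : ℝ} (hρ : 0 < ρ) (α : ℝ) {r : ℝ} (hr : 0 < r) :
    ∃ b', HasDerivAt (carlemanPotential d ρ α) b' r ∧
      r * b' + d * carlemanPotential d ρ α r =
        phiWeight (r / ρ) ^ (-(2 * α)) / r ^ 2 *
          (2 * α * Real.exp (-(r / ρ)) * carlemanCoeff d ρ α r ^ 2
            + α ^ 2 * (r / ρ) * Real.exp (-(r / ρ)) ^ 2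
            + α * (r / ρ) * (1 - r / ρ) * Real.exp (-(r / ρ)) / 2) := by
  have h1 := hasDerivAt_phiWeight_div_rpow hρ (-(2 * α)) hr
  have h2 : HasDerivAt (fun r : ℝ => (r ^ 2)⁻¹) _ r := (hasDerivAt_pow 2 r).inv (pow_pos hr 2).ne'
  have h3 := (((hasDerivAt_exp_neg_div ρ r).const_mul α).mul
    (((hasDerivAt_id r).div_const ρ).add
      ((hasDerivAt_carlemanCoeff d ρ α r).const_mul 2))).div_const 2
  refine ⟨_, (h1.mul h2).mul h3, ?_⟩
  simp only [carlemanPotential, carlemanCoeff, Pi.mul_apply, Pi.add_apply, id]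
  generalize phiWeight (r / ρ) ^ (-(2 * α)) = m
  generalize Real.exp (-(r / ρ)) = η
  field_simp
  ring

theorem sum_fderiv_rellichField_carleman {ρ : ℝ} (hρ : 0 < ρ) (α : ℝ)
    {f : EuclideanSpace ℝ (Fin d) → ℝ} (hf : ContDiff ℝ 2 f) {x : EuclideanSpace ℝ (Fin d)}
    (hx : x ≠ 0) :
    ∃ A, ∑ i, fderiv ℝ (rellichField (fun r => phiWeight (r / ρ) ^ (-(2 * α)))
        (carlemanCoeff d ρ α) (carlemanPotential d ρ α) f i) x (EuclideanSpace.single i 1) =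
      phiWeight (‖x‖ / ρ) ^ (-(2 * α)) *
        (A * lap f x - (2 * α * Real.exp (-(‖x‖ / ρ)) * A ^ 2
          + (α ^ 2 * (‖x‖ / ρ) * Real.exp (-(‖x‖ / ρ)) ^ 2
            + α * (‖x‖ / ρ) * (1 - ‖x‖ / ρ) * Real.exp (-(‖x‖ / ρ)) / 2) * f x ^ 2)
          / ‖x‖ ^ 2) := by
  have hr : 0 < ‖x‖ := norm_pos_iff.2 hx
  obtain ⟨b', hb, hb'⟩ := hasDerivAt_carlemanPotential d hρ α hr
  rw [sum_fderiv_rellichField hf hx (hasDerivAt_phiWeight_div_rpow hρ (-(2 * α)) hr)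
    (hasDerivAt_carlemanCoeff d ρ α ‖x‖) hb, hb']
  refine ⟨(∑ j, x j * fderiv ℝ f x (EuclideanSpace.single j 1))
    + carlemanCoeff d ρ α ‖x‖ * f x, ?_⟩
  simp only [carlemanPotential, carlemanCoeff]
  generalize phiWeight (‖x‖ / ρ) ^ (-(2 * α)) = m
  generalize Real.exp (-(‖x‖ / ρ)) = η
  generalize ‖x‖ = r at *
  field_simp
  ring

theorem carleman_pointwise_bound {ρ α s η w m A L F e : ℝ} (hρ : 0 < ρ) (hα : 0 < α) (hs : 0 < s)
    (hs1 : s < 1) (he : 0 < e) (hη : e ≤ η) (hw : s * e ≤ w) (hm : 0 ≤ m) :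
    8 * α * ρ ^ 2 * (m * (A * L - (2 * α * η * A ^ 2
        + (α ^ 2 * s * η ^ 2 + α * s * (1 - s) * η / 2) * F ^ 2) / (ρ * s) ^ 2))
      ≤ ρ ^ 4 / e ^ 3 * (m * w ^ 2 * L ^ 2) - 8 * e ^ 3 * α ^ 3 * (m / w * F ^ 2) := by
  have hη0 : 0 < η := he.trans_le hη
  have hw0 : 0 < w := (mul_pos hs he).trans_le hw
  have h1 : 8 * α * ρ ^ 2 * (A * L - 2 * α * η * A ^ 2 / (ρ * s) ^ 2) ≤ ρ ^ 4 * s ^ 2 / η * L ^ 2 := by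
    have : ρ ^ 4 * s ^ 2 / η * L ^ 2 - 8 * α * ρ ^ 2 * (A * L - 2 * α * η * A ^ 2 / (ρ * s) ^ 2)
        = (ρ ^ 2 * s ^ 2 * L - 4 * α * η * A) ^ 2 / (η * s ^ 2) := by
      field_simp
      ring
    have h2 : 0 ≤ (ρ ^ 2 * s ^ 2 * L - 4 * α * η * A) ^ 2 / (η * s ^ 2) := by positivity
    linarith
  have h2 : s ^ 2 / η ≤ w ^ 2 / e ^ 3 := by
    calc s ^ 2 / η ≤ s ^ 2 / e := by gcongr
      _ = (s * e) ^ 2 / e ^ 3 := by field_simp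
      _ ≤ w ^ 2 / e ^ 3 := by gcongr
  have h3 : e ^ 3 / w ≤ η ^ 2 / s := by
    calc e ^ 3 / w ≤ e ^ 3 / (s * e) := by gcongr
      _ = e ^ 2 / s := by field_simp
      _ ≤ η ^ 2 / s := by gcongr
  have h4 : 0 ≤ 8 * α * ρ ^ 2 * (α * s * (1 - s) * η / 2 * F ^ 2 / (ρ * s) ^ 2) := by
    have : 0 < 1 - s := by linarith
    positivity
  have h5 : 8 * α * ρ ^ 2 * (α ^ 2 * s * η ^ 2 * F ^ 2 / (ρ * s) ^ 2)
      = 8 * α ^ 3 * F ^ 2 * (η ^ 2 / s) := by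
    field_simp
  have h6 : 8 * α ^ 3 * F ^ 2 * (e ^ 3 / w) ≤ 8 * α ^ 3 * F ^ 2 * (η ^ 2 / s) := by gcongr
  have h7 : ρ ^ 4 * L ^ 2 * (s ^ 2 / η) ≤ ρ ^ 4 * L ^ 2 * (w ^ 2 / e ^ 3) := by gcongr
  have h8 : 8 * α * ρ ^ 2 * (A * L - (2 * α * η * A ^ 2
        + (α ^ 2 * s * η ^ 2 + α * s * (1 - s) * η / 2) * F ^ 2) / (ρ * s) ^ 2)
      ≤ ρ ^ 4 * L ^ 2 * (w ^ 2 / e ^ 3) - 8 * α ^ 3 * F ^ 2 * (e ^ 3 / w) := by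
    calc _ = 8 * α * ρ ^ 2 * (A * L - 2 * α * η * A ^ 2 / (ρ * s) ^ 2)
          - 8 * α * ρ ^ 2 * (α ^ 2 * s * η ^ 2 * F ^ 2 / (ρ * s) ^ 2)
          - 8 * α * ρ ^ 2 * (α * s * (1 - s) * η / 2 * F ^ 2 / (ρ * s) ^ 2) := by ring
      _ ≤ _ := by
        have : ρ ^ 4 * s ^ 2 / η * L ^ 2 = ρ ^ 4 * L ^ 2 * (s ^ 2 / η) := by ring
        linarith
  calc _ = m * (8 * α * ρ ^ 2 * (A * L - (2 * α * η * A ^ 2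
        + (α ^ 2 * s * η ^ 2 + α * s * (1 - s) * η / 2) * F ^ 2) / (ρ * s) ^ 2)) := by ring
    _ ≤ m * (ρ ^ 4 * L ^ 2 * (w ^ 2 / e ^ 3) - 8 * α ^ 3 * F ^ 2 * (e ^ 3 / w)) := by gcongr
    _ = _ := by ring

end

/-- Carleman-type inequality: there are `C₂, C₃ > 0`, depending only on
`d`, such that for every `ρ > 0`, every `α ≥ C₂`, and every real-valued C² function `f` on
`ℝ^d` with closed support contained in `B(0,ρ) ∖ {0}`,
`α³ ∫ w_ρ^{-1-2α} f² ≤ C₃ ρ⁴ ∫ w_ρ^{2-2α} (Δf)²`. -/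
theorem carleman_inequality (d : ℕ) (hd : 1 ≤ d) :
    ∃ C₂ > (0 : ℝ), ∃ C₃ > (0 : ℝ), ∀ ρ : ℝ, 0 < ρ → ∀ α : ℝ, C₂ ≤ α →
      ∀ f : EuclideanSpace ℝ (Fin d) → ℝ, ContDiff ℝ 2 f →
        tsupport f ⊆ Metric.ball (0 : EuclideanSpace ℝ (Fin d)) ρ \ {0} →
        α ^ 3 * ∫ x : EuclideanSpace ℝ (Fin d),
            phiWeight (‖x‖ / ρ) ^ (-1 - 2 * α) * f x ^ 2 ≤
          C₃ * ρ ^ 4 * ∫ x : EuclideanSpace ℝ (Fin d),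
            phiWeight (‖x‖ / ρ) ^ (2 - 2 * α) * (lap f x) ^ 2 := by
  have he : 0 < Real.exp (-1) := Real.exp_pos _
  refine ⟨1, one_pos, 1 / (8 * Real.exp (-1) ^ 6), by positivity, fun ρ hρ α hα f hf hsupp => ?_⟩
  have hα0 : 0 < α := one_pos.trans_le hα
  have hc : HasCompactSupport f :=
    (isCompact_closedBall (0 : EuclideanSpace ℝ (Fin d)) ρ).of_isClosed_subset
      (isClosed_tsupport f) fun x hx => Metric.ball_subset_closedBall (hsupp hx).1
  have h0 : (0 : EuclideanSpace ℝ (Fin d)) ∉ tsupport f := fun h => (hsupp h).2 rfl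
  have hI := integrable_phiWeight_mul (g := fun x => f x ^ 2) hρ (-1 - 2 * α) hc h0
    (hf.continuous.pow 2)
    fun x hx => by simp [image_eq_zero_of_notMem_tsupport hx]
  have hJ := integrable_phiWeight_mul (g := fun x => lap f x ^ 2) hρ (2 - 2 * α) hc h0
    ((continuous_lap hf).pow 2)
    fun x hx => by simp [lap_eq_zero hx]
  obtain ⟨hD, hD0⟩ := integral_sum_fderiv_rellichField hf hc h0
    (fun r hr => contDiffAt_phiWeight_div_rpow hρ (-(2 * α)) hr)
    (fun r _ => (contDiff_carlemanCoeff d ρ α).contDiffAt)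
    (fun r hr => contDiffAt_carlemanPotential d hρ α hr)
  have hle := integral_mono (hD.const_mul (8 * α * ρ ^ 2))
    ((hJ.const_mul (ρ ^ 4 / Real.exp (-1) ^ 3)).sub
      (hI.const_mul (8 * Real.exp (-1) ^ 3 * α ^ 3))) (fun x => by
    by_cases hx : x ∈ tsupport f
    · have hx0 : x ≠ 0 := (hsupp hx).2
      have hs : 0 < ‖x‖ / ρ := div_pos (norm_pos_iff.2 hx0) hρ
      have hs1 : ‖x‖ / ρ < 1 := (div_lt_one hρ).2 (by simpa using (hsupp hx).1)
      have hw := phiWeight_pos hs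
      obtain ⟨A, hA⟩ := sum_fderiv_rellichField_carleman hρ α hf hx0
      have hb := carleman_pointwise_bound (A := A) (L := lap f x) (F := f x) hρ hα0 hs hs1 he
        (Real.exp_le_exp.2 (neg_le_neg hs1.le)) (mul_exp_neg_one_le_phiWeight hs.le hs1.le)
        (Real.rpow_nonneg hw.le (-(2 * α)))
      rw [mul_div_cancel₀ _ hρ.ne', ← hA] at hb
      refine hb.trans_eq ?_
      have e1 : phiWeight (‖x‖ / ρ) ^ (2 - 2 * α)
          = phiWeight (‖x‖ / ρ) ^ (-(2 * α)) * phiWeight (‖x‖ / ρ) ^ 2 := by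
        rw [← Real.rpow_natCast, ← Real.rpow_add hw]
        congr 1
        push_cast
        ring
      have e2 : phiWeight (‖x‖ / ρ) ^ (-1 - 2 * α)
          = phiWeight (‖x‖ / ρ) ^ (-(2 * α)) / phiWeight (‖x‖ / ρ) := by
        rw [← Real.rpow_sub_one hw.ne']
        congr 1
        ring
      simp only [Pi.sub_apply, e1, e2]
    · simp [sum_fderiv_rellichField_eq_zero _ _ _ hx, lap_eq_zero hx,
        image_eq_zero_of_notMem_tsupport hx])
  simp only [Pi.sub_apply] at hle
  rw [integral_const_mul, hD0, mul_zero, integral_sub (hJ.const_mul _) (hI.const_mul _),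
    integral_const_mul, integral_const_mul] at hle
  generalize (∫ x : EuclideanSpace ℝ (Fin d),
    phiWeight (‖x‖ / ρ) ^ (-1 - 2 * α) * f x ^ 2) = I at hle ⊢
  generalize (∫ x : EuclideanSpace ℝ (Fin d),
    phiWeight (‖x‖ / ρ) ^ (2 - 2 * α) * lap f x ^ 2) = J at hle ⊢
  generalize Real.exp (-1) = e at *
  have h8 : 0 < 8 * e ^ 3 := by positivity
  refine le_of_mul_le_mul_left ?_ h8
  calc 8 * e ^ 3 * (α ^ 3 * I) = 8 * e ^ 3 * α ^ 3 * I := by ring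
    _ ≤ ρ ^ 4 / e ^ 3 * J := by linarith
    _ = 8 * e ^ 3 * (1 / (8 * e ^ 6) * ρ ^ 4 * J) := by field_simp
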